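/- Let p ≥ 1 be an integer, let Λ : C_{2p,Lip}(ℝ^n) → ℝ be a sublinear expectation, and let P̄ denote the set of all Borel probability measures m on ℝ^n such that every f ∈ C_{2p−1,Lip}(ℝ^n) is m-integrable and ∫_{ℝ^n} f dm ≤ Λ[f]. Then P̄ is a compact subset of the space of Borel probability measures on ℝ^n equipped with the topology of weak convergence. -/

import Mathlib

open MeasureTheory

/-- The space `C_{q,Lip}(ℝ^n)` of locally Lipschitz functions with polynomial growth of
order `q`. -/
def CLip (q n : ℕ) : Set ((EuclideanSpace ℝ (Fin n)) → ℝ) :=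
  {f | ∃ K : ℝ, ∀ x x' : EuclideanSpace ℝ (Fin n),
    |f x - f x'| ≤ K * (1 + ‖x‖ ^ (q - 1) + ‖x'‖ ^ (q - 1)) * ‖x - x'‖}

open Filter

namespace CLip

variable {q n : ℕ} {f g : EuclideanSpace ℝ (Fin n) → ℝ}

lemma exists_nonneg_bound (hf : f ∈ CLip q n) :
    ∃ K : ℝ, 0 ≤ K ∧ ∀ x x' : EuclideanSpace ℝ (Fin n),
      |f x - f x'| ≤ K * (1 + ‖x‖ ^ (q - 1) + ‖x'‖ ^ (q - 1)) * ‖x - x'‖ := by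
  obtain ⟨K, hK⟩ := hf
  refine ⟨|K|, abs_nonneg K, fun x x' => (hK x x').trans ?_⟩
  gcongr
  exact le_abs_self K

lemma continuous (hf : f ∈ CLip q n) : Continuous f := by
  obtain ⟨K, hK⟩ := hf
  refine continuous_iff_continuousAt.2 fun x₀ => ?_
  refine tendsto_iff_dist_tendsto_zero.2 ?_
  refine squeeze_zero (fun _ => dist_nonneg) (fun x => (Real.dist_eq _ _).trans_le (hK x x₀)) ?_
  have hcont : Continuous fun x : EuclideanSpace ℝ (Fin n) =>
      K * (1 + ‖x‖ ^ (q - 1) + ‖x₀‖ ^ (q - 1)) * ‖x - x₀‖ := by fun_prop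
  simpa using hcont.tendsto x₀

lemma add_mem (hf : f ∈ CLip q n) (hg : g ∈ CLip q n) : f + g ∈ CLip q n := by
  obtain ⟨K, hK⟩ := hf
  obtain ⟨L, hL⟩ := hg
  refine ⟨K + L, fun x x' => ?_⟩
  calc |(f + g) x - (f + g) x'| = |(f x - f x') + (g x - g x')| := by
        simp only [Pi.add_apply]; ring_nf
    _ ≤ |f x - f x'| + |g x - g x'| := abs_add_le _ _
    _ ≤ _ := by linarith [hK x x', hL x x']

lemma smul_mem (hf : f ∈ CLip q n) (a : ℝ) : a • f ∈ CLip q n := by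
  obtain ⟨K, hK⟩ := hf
  refine ⟨|a| * K, fun x x' => ?_⟩
  calc |(a • f) x - (a • f) x'| = |a| * |f x - f x'| := by
        rw [← abs_mul]; simp only [Pi.smul_apply, smul_eq_mul]; ring_nf
    _ ≤ |a| * (K * (1 + ‖x‖ ^ (q - 1) + ‖x'‖ ^ (q - 1)) * ‖x - x'‖) := by
        gcongr; exact hK x x'
    _ = _ := by ring

lemma const_mem (q n : ℕ) (c : ℝ) : (fun _ => c) ∈ CLip q n := ⟨0, by simp⟩

lemma of_lipschitz {L : ℝ} (hL : ∀ x x', |f x - f x'| ≤ L * ‖x - x'‖) : f ∈ CLip q n := by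
  refine ⟨|L|, fun x x' => (hL x x').trans ?_⟩
  gcongr
  have h₁ : 0 ≤ ‖x‖ ^ (q - 1) := by positivity
  have h₂ : 0 ≤ ‖x'‖ ^ (q - 1) := by positivity
  nlinarith [le_abs_self L, abs_nonneg L, mul_nonneg (abs_nonneg L) h₁,
    mul_nonneg (abs_nonneg L) h₂]

lemma mono {r : ℕ} (hqr : q ≤ r) : CLip q n ⊆ CLip r n := by
  intro f hf
  obtain ⟨K, hK0, hK⟩ := exists_nonneg_bound hf
  have hpow (t : ℝ) (ht : 0 ≤ t) : t ^ (q - 1) ≤ 1 + t ^ (r - 1) := by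
    rcases le_total t 1 with h | h
    · linarith [pow_le_one₀ ht h (n := q - 1), pow_nonneg ht (r - 1)]
    · linarith [pow_le_pow_right₀ h (Nat.sub_le_sub_right hqr 1)]
  refine ⟨3 * K, fun x x' => (hK x x').trans ?_⟩
  rw [mul_comm 3 K, mul_assoc K 3]
  gcongr
  linarith [hpow ‖x‖ (norm_nonneg x), hpow ‖x'‖ (norm_nonneg x'),
    pow_nonneg (norm_nonneg x) (r - 1), pow_nonneg (norm_nonneg x') (r - 1)]

lemma norm_pow_mem (q n : ℕ) :
    (fun x : EuclideanSpace ℝ (Fin n) => ‖x‖ ^ q) ∈ CLip q n := by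
  refine ⟨q, fun x x' => (abs_pow_sub_pow_le ‖x‖ ‖x'‖ q).trans ?_⟩
  have hmax : max |‖x‖| |‖x'‖| ^ (q - 1) ≤ 1 + ‖x‖ ^ (q - 1) + ‖x'‖ ^ (q - 1) := by
    have h₁ : 0 ≤ ‖x‖ ^ (q - 1) := by positivity
    have h₂ : 0 ≤ ‖x'‖ ^ (q - 1) := by positivity
    rw [abs_norm, abs_norm]
    rcases max_choice ‖x‖ ‖x'‖ with h | h <;> rw [h] <;> linarith
  calc |‖x‖ - ‖x'‖| * q * max |‖x‖| |‖x'‖| ^ (q - 1)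
      ≤ ‖x - x'‖ * q * (1 + ‖x‖ ^ (q - 1) + ‖x'‖ ^ (q - 1)) := by
        gcongr; exact abs_norm_sub_norm_le x x'
    _ = _ := by ring

/-- Functions in `C_{q,Lip}` grow at most like `r ^ q` on balls of radius `r ≥ 1`. -/
lemma exists_growth_bound (hq : 1 ≤ q) (hf : f ∈ CLip q n) :
    ∃ A : ℝ, 0 ≤ A ∧ ∀ x, ∀ r : ℝ, 1 ≤ r → ‖x‖ ≤ r → |f x| ≤ A * r ^ q := by
  obtain ⟨K, hK0, hK⟩ := exists_nonneg_bound hf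
  refine ⟨|f 0| + 3 * K, by positivity, fun x r hr hxr => ?_⟩
  have hr1 : 1 ≤ r ^ (q - 1) := one_le_pow₀ hr
  have hrq : 1 ≤ r ^ q := one_le_pow₀ hr
  have hsum : 1 + ‖x‖ ^ (q - 1) + ‖(0 : EuclideanSpace ℝ (Fin n))‖ ^ (q - 1)
      ≤ 3 * r ^ (q - 1) := by
    have h₁ : ‖x‖ ^ (q - 1) ≤ r ^ (q - 1) := by gcongr
    have h₂ : ‖(0 : EuclideanSpace ℝ (Fin n))‖ ^ (q - 1) ≤ r ^ (q - 1) := by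
      gcongr; simpa using zero_le_one.trans hr
    linarith
  have hdiff : |f x - f 0| ≤ 3 * K * r ^ q :=
    calc |f x - f 0| ≤ _ := hK x 0
      _ ≤ K * (3 * r ^ (q - 1)) * r := by
        gcongr; simpa using hxr
      _ = 3 * K * (r ^ (q - 1) * r) := by ring
      _ = 3 * K * r ^ q := by rw [pow_sub_one_mul (by omega)]
  calc |f x| = |f 0 + (f x - f 0)| := by ring_nf
    _ ≤ |f 0| + |f x - f 0| := abs_add_le _ _
    _ ≤ |f 0| * r ^ q + 3 * K * r ^ q :=
        add_le_add (le_mul_of_one_le_right (abs_nonneg _) hrq) hdiff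
    _ = _ := by ring

/-- Adding a small multiple of `‖x‖ ^ (q + 1)` to a function in `C_{q,Lip}` makes it coercive. -/
lemma exists_radius_le (hq : 1 ≤ q) (hf : f ∈ CLip q n) {ε : ℝ} (hε : 0 < ε) (N : ℝ) :
    ∃ R : ℝ, ∀ x, R ≤ ‖x‖ → N ≤ f x + ε * ‖x‖ ^ (q + 1) := by
  obtain ⟨A, hA0, hA⟩ := exists_growth_bound hq hf
  refine ⟨max 1 ((A + |N|) / ε), fun x hx => ?_⟩
  have hx1 : 1 ≤ ‖x‖ := (le_max_left _ _).trans hx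
  have hx2 : A + |N| ≤ ‖x‖ * ε := (div_le_iff₀ hε).1 ((le_max_right _ _).trans hx)
  have hxq : 1 ≤ ‖x‖ ^ q := one_le_pow₀ hx1
  have h₁ := neg_le_of_abs_le (hA x ‖x‖ hx1 le_rfl)
  have h₂ : (A + |N|) * ‖x‖ ^ q ≤ ‖x‖ * ε * ‖x‖ ^ q := by gcongr
  have h₃ : |N| ≤ |N| * ‖x‖ ^ q := le_mul_of_one_le_right (abs_nonneg _) hxq
  rw [pow_succ]
  linarith [le_abs_self N]

lemma exists_lower_bound (hq : 1 ≤ q) (hf : f ∈ CLip q n) {ε : ℝ} (hε : 0 < ε) :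
    ∃ M : ℝ, 0 ≤ M ∧ ∀ x, -M ≤ f x + ε * ‖x‖ ^ (q + 1) := by
  obtain ⟨R, hR⟩ := exists_radius_le hq hf hε 0
  obtain ⟨A, hA0, hA⟩ := exists_growth_bound hq hf
  have hM : 0 ≤ A * max 1 R ^ q := by positivity
  refine ⟨A * max 1 R ^ q, hM, fun x => ?_⟩
  rcases le_total R ‖x‖ with h | h
  · linarith [hR x h]
  · have h₁ := neg_le_of_abs_le (hA x (max 1 R) (le_max_left _ _) (h.trans (le_max_right _ _)))
    have h₂ : 0 ≤ ε * ‖x‖ ^ (q + 1) := by positivity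
    linarith

/-- Truncating a coercive function in `C_{q,Lip}` from above gives a Lipschitz function. -/
lemma min_const_mem {r : ℕ} (hf : f ∈ CLip q n) {M N R : ℝ} (hM : ∀ x, -M ≤ f x)
    (hR : ∀ x, R ≤ ‖x‖ → N ≤ f x) : (fun x => min (f x) N) ∈ CLip r n := by
  obtain ⟨K, hK0, hK⟩ := exists_nonneg_bound hf
  have hB : ∀ x, |min (f x) N| ≤ |M| + |N| := fun x => by
    refine abs_le.2 ⟨?_, ?_⟩
    · refine le_min ?_ ?_
      · linarith [hM x, le_abs_self M, abs_nonneg N]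
      · linarith [neg_abs_le N, abs_nonneg M]
    · linarith [min_le_right (f x) N, le_abs_self N, abs_nonneg M]
  set B : ℝ := 2 * (|M| + |N|)
  set S : ℝ := |R| + 1
  have hB0 : 0 ≤ B := by positivity
  have hS0 : 0 ≤ S := by positivity
  have hL0 : 0 ≤ K * (1 + S ^ (q - 1) + S ^ (q - 1)) := by positivity
  refine of_lipschitz (L := B + K * (1 + S ^ (q - 1) + S ^ (q - 1))) fun x x' => ?_
  rcases le_total 1 ‖x - x'‖ with h1 | h1
  · calc |min (f x) N - min (f x') N| ≤ |min (f x) N| + |min (f x') N| := abs_sub _ _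
      _ ≤ B := by linarith [hB x, hB x']
      _ ≤ (B + K * (1 + S ^ (q - 1) + S ^ (q - 1))) * 1 := by linarith
      _ ≤ _ := by gcongr
  · by_cases hfar : R ≤ ‖x‖ ∧ R ≤ ‖x'‖
    · rw [min_eq_right (hR x hfar.1), min_eq_right (hR x' hfar.2), sub_self, abs_zero]
      positivity
    · have htri := abs_le.1 ((abs_norm_sub_norm_le x x').trans h1)
      have hnear : ‖x‖ ≤ S ∧ ‖x'‖ ≤ S := by
        have := le_abs_self R
        rw [not_and_or, not_le, not_le] at hfar
        rcases hfar with h | h <;> constructor <;> simp only [S] <;> linarith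
      calc |min (f x) N - min (f x') N| ≤ |f x - f x'| := by
            simpa using abs_min_sub_min_le_max (f x) N (f x') N
        _ ≤ _ := hK x x'
        _ ≤ (K * (1 + S ^ (q - 1) + S ^ (q - 1))) * ‖x - x'‖ := by
            gcongr
            exacts [hnear.1, hnear.2]
        _ ≤ _ := by gcongr; linarith

end CLip

/-- Monotone convergence for truncations from above of a function bounded from below. -/
lemma integrable_and_integral_le_of_forall_integral_min_le {α : Type*} [MeasurableSpace α]
    {μ : Measure α} [IsProbabilityMeasure μ] {h : α → ℝ} (hmeas : Measurable h) {M c : ℝ}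
    (hM0 : 0 ≤ M) (hM : ∀ x, -M ≤ h x) (hc : ∀ N : ℕ, ∫ x, min (h x) N ∂μ ≤ c) :
    Integrable h μ ∧ ∫ x, h x ∂μ ≤ c := by
  have hlow (N : ℕ) (x : α) : 0 ≤ min (h x) N + M := by
    have : -M ≤ min (h x) N := le_min (hM x) (by linarith [Nat.cast_nonneg (α := ℝ) N])
    linarith
  have hint (N : ℕ) : Integrable (fun x => min (h x) N) μ := by
    refine Integrable.of_bound (C := M + N) (by fun_prop) (ae_of_all _ fun x => ?_)
    have hN := Nat.cast_nonneg (α := ℝ) N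
    refine abs_le.2 ⟨?_, ?_⟩
    · linarith [hlow N x]
    · linarith [min_le_right (h x) N]
  have heq (N : ℕ) : ∫ x, (min (h x) N + M) ∂μ = ∫ x, min (h x) N ∂μ + M := by
    rw [integral_add (hint N) (integrable_const M)]; simp
  have hcM : 0 ≤ c + M := by
    have : 0 ≤ ∫ x, (min (h x) (0 : ℕ) + M) ∂μ := integral_nonneg fun x => hlow 0 x
    linarith [heq 0, hc 0]
  have hlint : ∫⁻ x, ENNReal.ofReal (h x + M) ∂μ ≤ ENNReal.ofReal (c + M) := by
    have hlim (x : α) : liminf (fun N : ℕ => ENNReal.ofReal (min (h x) N + M)) atTop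
        = ENNReal.ofReal (h x + M) := by
      refine Tendsto.liminf_eq (tendsto_const_nhds.congr' ?_)
      filter_upwards [eventually_ge_atTop ⌈h x⌉₊] with N hN
      rw [min_eq_left (Nat.ceil_le.1 hN)]
    calc ∫⁻ x, ENNReal.ofReal (h x + M) ∂μ
        = ∫⁻ x, liminf (fun N : ℕ => ENNReal.ofReal (min (h x) N + M)) atTop ∂μ := by
          simp_rw [hlim]
      _ ≤ liminf (fun N : ℕ => ∫⁻ x, ENNReal.ofReal (min (h x) N + M) ∂μ) atTop :=
          lintegral_liminf_le fun N => by fun_prop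
      _ ≤ ENNReal.ofReal (c + M) := by
          refine liminf_le_of_le (by isBoundedDefault) fun b hb => ?_
          obtain ⟨N, hN⟩ := hb.exists
          refine hN.trans ?_
          have hintN : Integrable (fun x => min (h x) N + M) μ := (hint N).add (integrable_const M)
          rw [← ofReal_integral_eq_lintegral_ofReal hintN (ae_of_all _ (hlow N))]
          exact ENNReal.ofReal_le_ofReal (by simpa [heq N] using hc N)
  have hnonneg (x : α) : 0 ≤ h x + M := by linarith [hM x]
  have hintM : Integrable (fun x => h x + M) μ := by
    refine ⟨by fun_prop, ?_⟩
    rw [hasFiniteIntegral_iff_ofReal (ae_of_all _ hnonneg)]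
    exact hlint.trans_lt ENNReal.ofReal_lt_top
  have hinth : Integrable h μ := by
    simpa [Pi.sub_def] using hintM.sub (integrable_const M)
  refine ⟨hinth, ?_⟩
  rw [← ofReal_integral_eq_lintegral_ofReal hintM (ae_of_all _ hnonneg),
    ENNReal.ofReal_le_ofReal_iff hcM, integral_add hinth (integrable_const M)] at hlint
  simpa using hlint

/-- A family of probability measures with uniformly bounded moments of a positive order
is tight. -/
lemma isTightMeasureSet_of_integral_norm_pow_le {E : Type*} [NormedAddCommGroup E]
    [ProperSpace E] [MeasurableSpace E] {S : Set (ProbabilityMeasure E)} {k : ℕ} (hk : k ≠ 0)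
    {C : ℝ} (hS : ∀ μ ∈ S, Integrable (fun x => ‖x‖ ^ k) (μ : Measure E) ∧
      ∫ x, ‖x‖ ^ k ∂(μ : Measure E) ≤ C) :
    IsTightMeasureSet {((μ : ProbabilityMeasure E) : Measure E) | μ ∈ S} := by
  refine isTightMeasureSet_iff_exists_isCompact_measure_compl_le.2 fun ε hε => ?_
  obtain ⟨δ, hδ0, hδε⟩ : ∃ δ : ℝ, 0 < δ ∧ ENNReal.ofReal δ ≤ ε := by
    obtain ⟨δ, h0, h1⟩ := ENNReal.lt_iff_exists_nnreal_btwn.1 hε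
    exact ⟨δ, by exact_mod_cast h0, by simpa using h1.le⟩
  set r : ℝ := max 1 (C / δ)
  refine ⟨Metric.closedBall 0 r, isCompact_closedBall 0 r, ?_⟩
  rintro _ ⟨μ, hμ, rfl⟩
  obtain ⟨hint, hle⟩ := hS μ hμ
  have hr1 : 1 ≤ r := le_max_left _ _
  have hr0 : 0 < r := one_pos.trans_le hr1
  have hCr : C ≤ δ * r := by
    rw [mul_comm]; exact (div_le_iff₀ hδ0).1 (le_max_right _ _)
  have hmarkov := mul_meas_ge_le_integral_of_nonneg
    (ae_of_all _ fun x : E => by positivity) hint r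
  have hreal : (μ : Measure E).real {x | r ≤ ‖x‖ ^ k} ≤ δ := by
    by_contra! hlt
    have := mul_lt_mul_of_pos_left hlt hr0
    linarith
  calc (μ : Measure E) (Metric.closedBall 0 r)ᶜ ≤ (μ : Measure E) {x | r ≤ ‖x‖ ^ k} := by
        refine measure_mono fun x hx => ?_
        have hx' : r < ‖x‖ := by simpa using hx
        exact hx'.le.trans (le_self_pow₀ (hr1.trans hx'.le) hk)
    _ = ENNReal.ofReal ((μ : Measure E).real {x | r ≤ ‖x‖ ^ k}) := by simp
    _ ≤ ε := (ENNReal.ofReal_le_ofReal hreal).trans hδε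

/-- Upper bounds on the integrals of bounded continuous functions define a weakly closed set. -/
lemma isClosed_setOf_integral_le {E : Type*} [TopologicalSpace E] [MeasurableSpace E]
    [OpensMeasurableSpace E] {g : E → ℝ} (hg : Continuous g) {B : ℝ} (hB : ∀ x, |g x| ≤ B)
    (c : ℝ) : IsClosed {μ : ProbabilityMeasure E | ∫ x, g x ∂(μ : Measure E) ≤ c} := by
  let G : BoundedContinuousFunction E ℝ := BoundedContinuousFunction.ofNormedAddCommGroup g hg B hB
  refine isClosed_le (f := fun μ : ProbabilityMeasure E => ∫ x, g x ∂(μ : Measure E))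
    (continuous_iff_continuousAt.2 fun μ => ?_) continuous_const
  exact ProbabilityMeasure.tendsto_iff_forall_integral_tendsto.1 tendsto_id G

/-- the set `P̄` of Borel probability measures dominated by a sublinear
expectation is compact in the topology of weak convergence of probability measures. -/
theorem Pbar_weakly_compact
    (n p : ℕ) (hp : 1 ≤ p)
    (Λ : ((EuclideanSpace ℝ (Fin n)) → ℝ) → ℝ)
    (hmono : ∀ f ∈ CLip (2 * p) n, ∀ g ∈ CLip (2 * p) n, (∀ x, g x ≤ f x) → Λ g ≤ Λ f)
    (hconstpres : ∀ c : ℝ, Λ (fun _ => c) = c)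
    (hsubadd : ∀ f ∈ CLip (2 * p) n, ∀ g ∈ CLip (2 * p) n, Λ (f + g) ≤ Λ f + Λ g)
    (hposhom : ∀ f ∈ CLip (2 * p) n, ∀ a : ℝ, 0 ≤ a → Λ (a • f) = a * Λ f) :
    IsCompact {μ : ProbabilityMeasure (EuclideanSpace ℝ (Fin n)) |
      ∀ f ∈ CLip (2 * p - 1) n,
        Integrable f (μ : Measure (EuclideanSpace ℝ (Fin n))) ∧
        ∫ x, f x ∂(μ : Measure (EuclideanSpace ℝ (Fin n))) ≤ Λ f} := by
  have hq : 1 ≤ 2 * p - 1 := by omega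
  have hq2 : 2 * p - 1 + 1 = 2 * p := by omega
  have hsub : CLip (2 * p - 1) n ⊆ CLip (2 * p) n := CLip.mono (by omega)
  set V : EuclideanSpace ℝ (Fin n) → ℝ := fun x => ‖x‖ ^ (2 * p)
  have hV : V ∈ CLip (2 * p) n := CLip.norm_pow_mem (2 * p) n
  have hC : 0 ≤ Λ V := by
    have := hmono V hV _ (CLip.const_mem _ _ 0) fun x => by positivity
    rwa [hconstpres] at this
  set S : Set (ProbabilityMeasure (EuclideanSpace ℝ (Fin n))) :=
    {μ | ∀ f ∈ CLip (2 * p - 1) n, (∃ B : ℝ, ∀ x, |f x| ≤ B) →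
      ∫ x, f x ∂(μ : Measure (EuclideanSpace ℝ (Fin n))) ≤ Λ f}
  have hperturb : ∀ μ ∈ S, ∀ f ∈ CLip (2 * p - 1) n, ∀ ε : ℝ, 0 < ε →
      Integrable (fun x => f x + ε * V x) (μ : Measure (EuclideanSpace ℝ (Fin n))) ∧
      ∫ x, (f x + ε * V x) ∂(μ : Measure (EuclideanSpace ℝ (Fin n))) ≤ Λ f + ε * Λ V := by
    intro μ hμ f hf ε hε
    have hεV : ε • V ∈ CLip (2 * p) n := CLip.smul_mem hV ε
    have hh : (f + ε • V) ∈ CLip (2 * p) n := CLip.add_mem (hsub hf) hεV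
    obtain ⟨M, hM0, hM⟩ := CLip.exists_lower_bound hq hf hε
    rw [hq2] at hM
    refine integrable_and_integral_le_of_forall_integral_min_le
      (CLip.continuous hh).measurable hM0 hM fun N => ?_
    obtain ⟨R, hR⟩ := CLip.exists_radius_le hq hf hε N
    rw [hq2] at hR
    have hmem (r : ℕ) : (fun x => min ((f + ε • V) x) (N : ℝ)) ∈ CLip r n :=
      CLip.min_const_mem hh hM hR
    calc ∫ x, min ((f + ε • V) x) (N : ℝ) ∂(μ : Measure (EuclideanSpace ℝ (Fin n)))
        ≤ Λ (fun x => min ((f + ε • V) x) (N : ℝ)) := by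
          refine hμ _ (hmem _) ⟨M + N, fun x => abs_le.2 ⟨?_, ?_⟩⟩
          · exact le_min (by linarith [hM x, show (f + ε • V) x = f x + ε * ‖x‖ ^ (2 * p) from rfl,
              Nat.cast_nonneg (α := ℝ) N]) (by linarith [Nat.cast_nonneg (α := ℝ) N])
          · linarith [min_le_right ((f + ε • V) x) (N : ℝ)]
      _ ≤ Λ (f + ε • V) := hmono _ hh _ (hmem _) fun x => min_le_left _ _
      _ ≤ Λ f + Λ (ε • V) := hsubadd f (hsub hf) _ hεV
      _ = Λ f + ε * Λ V := by rw [hposhom V hV ε hε.le]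
  have hmoment : ∀ μ ∈ S, Integrable V (μ : Measure (EuclideanSpace ℝ (Fin n))) ∧
      ∫ x, V x ∂(μ : Measure (EuclideanSpace ℝ (Fin n))) ≤ Λ V := by
    intro μ hμ
    simpa [hconstpres] using hperturb μ hμ _ (CLip.const_mem _ _ 0) 1 one_pos
  have hclosed : IsClosed S := by
    simp only [S, Set.ofPred_forall]
    refine isClosed_iInter fun f => isClosed_iInter fun hf => isClosed_iInter fun hB => ?_
    exact isClosed_setOf_integral_le (CLip.continuous hf) hB.choose_spec (Λ f)
  have hcompact : IsCompact S := by
    have := isCompact_closure_of_isTightMeasureSet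
      (isTightMeasureSet_of_integral_norm_pow_le (by omega) hmoment)
    rwa [hclosed.closure_eq] at this
  convert hcompact using 1
  refine Set.Subset.antisymm (fun μ hμ f hf _ => (hμ f hf).2) fun μ hμ f hf => ?_
  obtain ⟨hVint, -⟩ := hmoment μ hμ
  have hfint : Integrable f (μ : Measure (EuclideanSpace ℝ (Fin n))) := by
    simpa [Pi.sub_def] using (hperturb μ hμ f hf 1 one_pos).1.sub (hVint.const_mul 1)
  refine ⟨hfint, le_of_forall_pos_le_add fun δ hδ => ?_⟩
  have hε : 0 < δ / (Λ V + 1) := by positivity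
  have hle := (hperturb μ hμ f hf _ hε).2
  rw [integral_add hfint (hVint.const_mul _), integral_const_mul] at hle
  have hVnonneg : 0 ≤ ∫ x, V x ∂(μ : Measure (EuclideanSpace ℝ (Fin n))) :=
    integral_nonneg fun x => by positivity
  have hδ' : δ / (Λ V + 1) * Λ V ≤ δ := by
    rw [div_mul_eq_mul_div, div_le_iff₀ (by positivity)]
    nlinarith
  linarith [mul_nonneg hε.le hVnonneg]
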